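/- Let c > 0, d ≥ 1, and let v ∈ ℝ^d with v ≠ 0. Then exp_0^c is differentiable at v and the determinant of its derivative at v equals (1 − tanh²(√c ‖v‖)) · (tanh(√c ‖v‖)/(√c ‖v‖))^{d−1}. -/

import Mathlib

open Real
open scoped Classical

/-- The hyperbolic exponential map at the origin of the Poincaré ball of curvature
parameter `c`: `expMap c v = tanh (√c ‖v‖) • v / (√c ‖v‖)` for `v ≠ 0`, and `expMap c 0 = 0`. -/
noncomputable def expMap (c : ℝ) {d : ℕ} (v : EuclideanSpace ℝ (Fin d)) :
    EuclideanSpace ℝ (Fin d) :=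
  if v = 0 then 0 else (Real.tanh (Real.sqrt c * ‖v‖) / (Real.sqrt c * ‖v‖)) • v

theorem Real.hasDerivAt_tanh (x : ℝ) : HasDerivAt Real.tanh (1 - Real.tanh x ^ 2) x := by
  have hx : Real.cosh x ≠ 0 := (Real.cosh_pos x).ne'
  have h := (Real.hasDerivAt_sinh x).div (Real.hasDerivAt_cosh x) hx
  have hfun : Real.tanh = Real.sinh / Real.cosh := by
    ext y
    simp [Real.tanh_eq_sinh_div_cosh]
  rw [hfun]
  refine h.congr_deriv ?_
  simp only [Pi.div_apply]
  field_simp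

theorem hasFDerivAt_norm_of_ne_zero {E : Type*} [NormedAddCommGroup E] [InnerProductSpace ℝ E]
    {v : E} (hv : v ≠ 0) : HasFDerivAt (fun x : E => ‖x‖) (‖v‖⁻¹ • innerSL ℝ v) v := by
  have hn : ‖v‖ ≠ 0 := norm_ne_zero_iff.2 hv
  have h := (hasStrictFDerivAt_norm_sq v).hasFDerivAt.sqrt (pow_ne_zero 2 hn)
  simp only [Real.sqrt_sq (norm_nonneg _)] at h
  refine h.congr_fderiv ?_
  ext y
  simp
  field_simp

/-- The derivative of a radial map `x ↦ g ‖x‖ • x` away from the origin. -/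
theorem HasDerivAt.hasFDerivAt_norm_smul {E : Type*} [NormedAddCommGroup E]
    [InnerProductSpace ℝ E] {g : ℝ → ℝ} {g' : ℝ} {v : E} (hv : v ≠ 0)
    (hg : HasDerivAt g g' ‖v‖) :
    HasFDerivAt (fun x : E => g ‖x‖ • x)
      (g ‖v‖ • ContinuousLinearMap.id ℝ E +
        ((g' * ‖v‖⁻¹) • innerSL ℝ v).smulRight v) v := by
  have h := (hg.comp_hasFDerivAt v (hasFDerivAt_norm_of_ne_zero hv)).smul (hasFDerivAt_id v)
  refine h.congr_fderiv ?_
  ext y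
  simp [smul_smul, mul_assoc]

theorem LinearMap.det_smul_id_add_smulRight {K V : Type*} [Field K] [AddCommGroup V] [Module K V]
    [FiniteDimensional K V] {a : K} (ha : a ≠ 0) (f : Module.Dual K V) (v : V) :
    LinearMap.det (a • LinearMap.id + f.smulRight v) =
      a ^ Module.finrank K V * (1 + a⁻¹ * f v) := by
  have h : a • LinearMap.id + f.smulRight v = a • LinearMap.transvection (a⁻¹ • f) v := by
    ext y
    simp [LinearMap.transvection, smul_smul, ha]
  rw [h, LinearMap.det_smul, LinearMap.transvection.det]
  simp

/-- For `c > 0`, `d ≥ 1`, and `v ≠ 0`, `expMap c` is differentiable at `v`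
and the determinant of its derivative at `v` equals
`(1 - tanh² (√c ‖v‖)) * (tanh (√c ‖v‖)/(√c ‖v‖))^(d-1)`. -/
theorem stmt13 (c : ℝ) (hc : 0 < c) {d : ℕ} (hd : 1 ≤ d)
    (v : EuclideanSpace ℝ (Fin d)) (hv : v ≠ 0) :
    DifferentiableAt ℝ (expMap c (d := d)) v ∧
    LinearMap.det (fderiv ℝ (expMap c (d := d)) v).toLinearMap =
      (1 - Real.tanh (Real.sqrt c * ‖v‖) ^ 2) *
        (Real.tanh (Real.sqrt c * ‖v‖) / (Real.sqrt c * ‖v‖)) ^ (d - 1) := by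
  have hr : ‖v‖ ≠ 0 := norm_ne_zero_iff.2 hv
  have hs : Real.sqrt c ≠ 0 := (Real.sqrt_pos.2 hc).ne'
  have ht : Real.tanh (Real.sqrt c * ‖v‖) ≠ 0 := by
    rw [Real.tanh_eq_sinh_div_cosh]
    exact div_ne_zero (Real.sinh_ne_zero.2 (mul_ne_zero hs hr)) (Real.cosh_pos _).ne'
  have hlin : HasDerivAt (fun r : ℝ => Real.sqrt c * r) (Real.sqrt c) ‖v‖ := by
    simpa using (hasDerivAt_id ‖v‖).const_mul (Real.sqrt c)
  have hg := ((Real.hasDerivAt_tanh _).comp ‖v‖ hlin).div hlin (mul_ne_zero hs hr)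
  have hfun : expMap c (d := d) =
      fun x => (Real.tanh (Real.sqrt c * ‖x‖) / (Real.sqrt c * ‖x‖)) • x := by
    ext1 x
    by_cases hx : x = 0 <;> simp [expMap, hx]
  have hF := hg.hasFDerivAt_norm_smul hv
  simp only [Pi.div_apply, Function.comp_apply] at hF
  rw [← hfun] at hF
  refine ⟨hF.differentiableAt, ?_⟩
  rw [hF.fderiv]
  refine (LinearMap.det_smul_id_add_smulRight (div_ne_zero ht (mul_ne_zero hs hr))
    (((_ : ℝ) • innerSL ℝ v : EuclideanSpace ℝ (Fin d) →L[ℝ] ℝ) :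
      Module.Dual ℝ (EuclideanSpace ℝ (Fin d))) v).trans ?_
  obtain ⟨n, rfl⟩ : ∃ n, d = n + 1 := ⟨d - 1, by omega⟩
  simp only [finrank_euclideanSpace, Fintype.card_fin, Nat.add_sub_cancel, pow_succ,
    ContinuousLinearMap.coe_coe, smul_apply, innerSL_apply_apply,
    real_inner_self_eq_norm_sq, smul_eq_mul]
  rw [mul_assoc, mul_comm]
  congr 1
  field_simp
  ring
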